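/- Let D be a positive integer and let Γ ⊆ ℝ^D be an orthosymmetric, compact, convex and quadratically convex set. There exists a universal constant c₀ > 0 such that for every ε > 0, if the positive integers (m, n) satisfy m ≥ c₀/ε², n ≥ c₀·√(n_est(Γ, ε/9))/ε, and m·n ≥ c₀²·n_est(Γ, ε/9)², then (m, n) is LFHT-feasible for Γ at separation ε. -/

import Mathlib

open MeasureTheory ProbabilityTheory Real

/-- The standard multivariate Gaussian `N(θ, I_D)` on `ℝ^D`, as a product of
one-dimensional Gaussians with unit variance. -/
noncomputable def gaussPi {D : ℕ} (θ : Fin D → ℝ) : Measure (Fin D → ℝ) :=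
  Measure.pi (fun i => gaussianReal (θ i) 1)

/-- The joint law of `n` i.i.d. samples from `ν`. -/
noncomputable def iidSamples {E : Type*} [MeasurableSpace E] (n : ℕ) (ν : Measure E) :
    Measure (Fin n → E) :=
  Measure.pi (fun _ => ν)

/-- Euclidean norm on `ℝ^D`. -/
noncomputable def euclNorm {D : ℕ} (θ : Fin D → ℝ) : ℝ :=
  Real.sqrt (∑ i, (θ i) ^ 2)

/-- A set `Γ ⊆ ℝ^D` is orthosymmetric if it is closed under coordinatewise sign flips. -/
def Orthosymmetric {D : ℕ} (Γ : Set (Fin D → ℝ)) : Prop :=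
  ∀ θ ∈ Γ, ∀ s : Fin D → ℝ, (∀ i, s i = 1 ∨ s i = -1) → (fun i => s i * θ i) ∈ Γ

/-- Goodness-of-fit sample complexity: the smallest `n` for which there is a measurable test
`ψ` with type-I error at most `1/4` under `N(0, I_D)` and type-II error at most `1/4` under
every `N(θ, I_D)` with `θ ∈ Γ`, `‖θ‖₂ ≥ ε`. -/
noncomputable def nGof {D : ℕ} (Γ : Set (Fin D → ℝ)) (ε : ℝ) : ℕ :=
  sInf {n : ℕ | ∃ ψ : (Fin n → (Fin D → ℝ)) → Bool, Measurable ψ ∧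
    (iidSamples n (gaussPi (0 : Fin D → ℝ))) {x | ψ x = true} ≤ 1/4 ∧
    ∀ θ ∈ Γ, ε ≤ euclNorm θ →
      (iidSamples n (gaussPi θ)) {x | ψ x = false} ≤ 1/4}

/-- Estimation sample complexity: the smallest `n` for which there is a measurable estimator
whose worst-case expected squared Euclidean error over `Γ` is at most `ε²`. -/
noncomputable def nEst {D : ℕ} (Γ : Set (Fin D → ℝ)) (ε : ℝ) : ℕ :=
  sInf {n : ℕ | ∃ est : (Fin n → (Fin D → ℝ)) → (Fin D → ℝ), Measurable est ∧
    ∀ θ ∈ Γ,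
      (∫⁻ x, ENNReal.ofReal (∑ i, (est x i - θ i) ^ 2) ∂(iidSamples n (gaussPi θ)))
        ≤ ENNReal.ofReal (ε ^ 2)}

/-- A set `Γ ⊆ ℝ^D` is quadratically convex if the set of coordinatewise squares of its
elements is convex. -/
def QuadraticallyConvex {D : ℕ} (Γ : Set (Fin D → ℝ)) : Prop :=
  Convex ℝ ((fun θ : Fin D → ℝ => fun i => (θ i) ^ 2) '' Γ)

/-- `(m, n)` is LFHT-feasible for `Γ` at separation `ε`: there is a measurable test using
`n` samples from each of the two simulated distributions and `m` samples from the real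
distribution which errs with probability at most `1/4` under both hypotheses, for every
pair `θ¹, θ² ∈ Γ` with `‖θ¹ − θ²‖₂ ≥ ε`. -/
def LFHTFeasible {D : ℕ} (Γ : Set (Fin D → ℝ)) (ε : ℝ) (m n : ℕ) : Prop :=
  ∃ ψ : (Fin n → (Fin D → ℝ)) × (Fin n → (Fin D → ℝ)) × (Fin m → (Fin D → ℝ)) → Bool,
    Measurable ψ ∧
    ∀ θ1 ∈ Γ, ∀ θ2 ∈ Γ, ε ≤ euclNorm (θ1 - θ2) →
      (((iidSamples n (gaussPi θ1)).prod
        ((iidSamples n (gaussPi θ2)).prod (iidSamples m (gaussPi θ1))))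
          {x | ψ x = true} ≤ 1/4 ∧
       ((iidSamples n (gaussPi θ1)).prod
        ((iidSamples n (gaussPi θ2)).prod (iidSamples m (gaussPi θ2))))
          {x | ψ x = false} ≤ 1/4)

/-! ### Densities of product measures -/

theorem lintegral_pi_prod {ι : Type*} [Fintype ι] {α : ι → Type*} [∀ i, MeasurableSpace (α i)]
    (μ : ∀ i, Measure (α i)) [∀ i, IsProbabilityMeasure (μ i)] {f : ∀ i, α i → ENNReal}
    (hf : ∀ i, Measurable (f i)) :
    ∫⁻ x, ∏ i, f i (x i) ∂Measure.pi μ = ∏ i, ∫⁻ x, f i x ∂μ i := by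
  have hind : iIndepFun (fun i (x : ∀ i, α i) => f i (x i)) (Measure.pi μ) :=
    iIndepFun_pi (X := f) fun i => (hf i).aemeasurable
  rw [lintegral_prod_eq_prod_lintegral_of_indepFun Finset.univ _ hind fun i =>
    (hf i).comp (measurable_pi_apply i)]
  exact Finset.prod_congr rfl fun i _ => (measurePreserving_eval μ i).lintegral_comp (hf i)

theorem pi_withDensity {ι : Type*} [Fintype ι] {α : ι → Type*} [∀ i, MeasurableSpace (α i)]
    (μ : ∀ i, Measure (α i)) [∀ i, IsProbabilityMeasure (μ i)] {f : ∀ i, α i → ENNReal}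
    (hf : ∀ i, Measurable (f i)) [∀ i, SigmaFinite ((μ i).withDensity (f i))] :
    Measure.pi (fun i => (μ i).withDensity (f i)) =
      (Measure.pi μ).withDensity fun x => ∏ i, f i (x i) := by
  refine Measure.pi_eq fun s hs => ?_
  rw [withDensity_apply _ (MeasurableSet.univ_pi hs), ← lintegral_indicator (MeasurableSet.univ_pi hs)]
  have hind : (Set.univ.pi s).indicator (fun x => ∏ i, f i (x i)) =
      fun x => ∏ i, (s i).indicator (f i) (x i) := by
    ext x
    by_cases hx : x ∈ Set.univ.pi s
    · rw [Set.indicator_of_mem hx]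
      exact Finset.prod_congr rfl fun i _ => (Set.indicator_of_mem (hx i trivial) _).symm
    · rw [Set.indicator_of_notMem hx]
      simp only [Set.mem_pi, Set.mem_univ, forall_const, not_forall] at hx
      obtain ⟨i, hi⟩ := hx
      exact (Finset.prod_eq_zero (Finset.mem_univ i) (Set.indicator_of_notMem hi _)).symm
  rw [hind, lintegral_pi_prod μ fun i => (hf i).indicator (hs i)]
  exact Finset.prod_congr rfl fun i _ => by
    rw [withDensity_apply _ (hs i), lintegral_indicator (hs i)]

/-! ### Likelihood ratios of Gaussian shifts -/

/-- The likelihood ratio of `N(p + d, 1)` with respect to `N(p, 1)`. -/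
noncomputable def shiftRatio (p d x : ℝ) : ENNReal :=
  ENNReal.ofReal (rexp (d * (x - p) - d ^ 2 / 2))

theorem measurable_shiftRatio (p d : ℝ) : Measurable (shiftRatio p d) := by
  unfold shiftRatio; fun_prop

theorem gaussianReal_withDensity_shiftRatio (p d : ℝ) :
    (gaussianReal p 1).withDensity (shiftRatio p d) = gaussianReal (p + d) 1 := by
  rw [gaussianReal_of_var_ne_zero _ one_ne_zero, gaussianReal_of_var_ne_zero _ one_ne_zero,
    ← withDensity_mul _ (measurable_gaussianPDF _ _) (measurable_shiftRatio p d)]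
  congr 1
  ext x
  simp only [Pi.mul_apply, gaussianPDF, shiftRatio, gaussianPDFReal]
  rw [← ENNReal.ofReal_mul (by positivity), mul_assoc, ← Real.exp_add]
  congr 3
  simp only [NNReal.coe_one]
  ring

theorem lintegral_exp_mul_gaussianReal (p t : ℝ) :
    ∫⁻ x, ENNReal.ofReal (rexp (t * x)) ∂gaussianReal p 1 =
      ENNReal.ofReal (rexp (p * t + t ^ 2 / 2)) := by
  rw [← ofReal_integral_eq_lintegral_ofReal (integrable_exp_mul_gaussianReal t)
    (ae_of_all _ fun _ => (exp_pos _).le)]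
  have := congrFun (mgf_id_gaussianReal (μ := p) (v := 1)) t
  simp only [mgf, id, NNReal.coe_one, one_mul] at this
  rw [this]

theorem lintegral_shiftRatio_sq (p d : ℝ) :
    ∫⁻ x, shiftRatio p d x ^ 2 ∂gaussianReal p 1 = ENNReal.ofReal (rexp (d ^ 2)) := by
  have h : ∀ x, shiftRatio p d x ^ 2 =
      ENNReal.ofReal (rexp (-(2 * d * p) - d ^ 2)) * ENNReal.ofReal (rexp (2 * d * x)) := by
    intro x
    rw [shiftRatio, ← ENNReal.ofReal_pow (exp_pos _).le, ← Real.exp_nat_mul,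
      ← ENNReal.ofReal_mul (exp_pos _).le, ← Real.exp_add]
    congr 2
    push_cast
    ring
  simp_rw [h]
  rw [lintegral_const_mul _ (by fun_prop), lintegral_exp_mul_gaussianReal,
    ← ENNReal.ofReal_mul (exp_pos _).le, ← Real.exp_add]
  congr 2
  ring

instance isProbabilityMeasure_gaussPi {D : ℕ} (θ : Fin D → ℝ) :
    IsProbabilityMeasure (gaussPi θ) := by
  unfold gaussPi; infer_instance

instance isProbabilityMeasure_iidSamples {E : Type*} [MeasurableSpace E] (n : ℕ) (ν : Measure E)
    [IsProbabilityMeasure ν] : IsProbabilityMeasure (iidSamples n ν) := by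
  unfold iidSamples; infer_instance

/-- The likelihood ratio of `n` samples from `N(θ + d, I)` with respect to `N(θ, I)`. -/
noncomputable def sampleRatio {D : ℕ} (n : ℕ) (θ d : Fin D → ℝ) (x : Fin n → Fin D → ℝ) : ENNReal :=
  ∏ k, ∏ j, shiftRatio (θ j) (d j) (x k j)

theorem measurable_prod_shiftRatio {D : ℕ} (θ d : Fin D → ℝ) :
    Measurable fun x : Fin D → ℝ => ∏ j, shiftRatio (θ j) (d j) (x j) :=
  Finset.measurable_fun_prod _ fun j _ =>
    (measurable_shiftRatio _ _).comp (measurable_pi_apply j)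

theorem measurable_sampleRatio {D : ℕ} (n : ℕ) (θ d : Fin D → ℝ) :
    Measurable (sampleRatio n θ d) :=
  Finset.measurable_fun_prod _ fun k _ =>
    (measurable_prod_shiftRatio θ d).comp (measurable_pi_apply k)

theorem gaussPi_withDensity {D : ℕ} (θ d : Fin D → ℝ) :
    (gaussPi θ).withDensity (fun x => ∏ j, shiftRatio (θ j) (d j) (x j)) = gaussPi (θ + d) := by
  have : ∀ j, SigmaFinite ((gaussianReal (θ j) 1).withDensity (shiftRatio (θ j) (d j))) := by
    intro j; rw [gaussianReal_withDensity_shiftRatio]; infer_instance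
  unfold gaussPi
  rw [← pi_withDensity _ fun j => measurable_shiftRatio (θ j) (d j)]
  simp_rw [gaussianReal_withDensity_shiftRatio, Pi.add_apply]

theorem iidSamples_withDensity {D : ℕ} (n : ℕ) (θ d : Fin D → ℝ) :
    (iidSamples n (gaussPi θ)).withDensity (sampleRatio n θ d) =
      iidSamples n (gaussPi (θ + d)) := by
  have : SigmaFinite ((gaussPi θ).withDensity
      (fun x => ∏ j, shiftRatio (θ j) (d j) (x j))) := by
    rw [gaussPi_withDensity]; infer_instance
  unfold iidSamples sampleRatio
  rw [← pi_withDensity (fun _ : Fin n => gaussPi θ) fun _ => measurable_prod_shiftRatio θ d]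
  simp_rw [gaussPi_withDensity]

theorem lintegral_sampleRatio_sq {D : ℕ} (n : ℕ) (θ d : Fin D → ℝ) :
    ∫⁻ x, sampleRatio n θ d x ^ 2 ∂iidSamples n (gaussPi θ) =
      ENNReal.ofReal (rexp (n * ∑ j, d j ^ 2)) := by
  unfold sampleRatio iidSamples
  simp_rw [← Finset.prod_pow]
  rw [lintegral_pi_prod (fun _ : Fin n => gaussPi θ) (f := fun _ x =>
    ∏ j, shiftRatio (θ j) (d j) (x j) ^ 2) fun _ => Finset.measurable_fun_prod _ fun j _ =>
    ((measurable_shiftRatio _ _).comp (measurable_pi_apply j)).pow_const 2]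
  unfold gaussPi
  rw [lintegral_pi_prod _ (f := fun j x => shiftRatio (θ j) (d j) x ^ 2)
    fun j => (measurable_shiftRatio _ _).pow_const 2]
  simp_rw [lintegral_shiftRatio_sq]
  rw [← ENNReal.ofReal_prod_of_nonneg fun _ _ => (exp_pos _).le, ← Real.exp_sum,
    Finset.prod_const, ← ENNReal.ofReal_pow (exp_pos _).le, ← Real.exp_nat_mul]
  simp

/-! ### Two-point lower bound -/

theorem sq_sub_mul_le_of_ratio (t a b l : ℝ) (hl : 0 ≤ l) :
    (a - b) ^ 2 * l ≤ 2 * ((t - a) ^ 2 + l * (t - b) ^ 2) + (a - b) ^ 2 / 4 * l ^ 2 := by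
  have h : (a - b) ^ 2 ≤ 2 * ((t - a) ^ 2 + (t - b) ^ 2) := by nlinarith [sq_nonneg (2 * t - a - b)]
  rcases le_total l 1 with h1 | h1
  · have := mul_le_mul_of_nonneg_right h hl
    nlinarith [mul_nonneg (sub_nonneg.2 h1) (sq_nonneg (t - a)),
      mul_nonneg (sq_nonneg (a - b)) (sq_nonneg l)]
  · nlinarith [mul_nonneg (sub_nonneg.2 h1) (sq_nonneg (t - b)),
      mul_nonneg (sq_nonneg (a - b)) (sq_nonneg (1 - l / 2))]

theorem two_point_lower_bound {α : Type*} [MeasurableSpace α] (P : Measure α)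
    {l : α → ENNReal} (hl : Measurable l) (hfin : ∀ x, l x ≠ ⊤)
    (hprob : P.withDensity l Set.univ = 1) (hsq : ∫⁻ x, l x ^ 2 ∂P ≤ 2)
    {T : α → ℝ} (hT : Measurable T) (a b : ℝ) :
    ENNReal.ofReal ((a - b) ^ 2 / 4) ≤ ∫⁻ x, ENNReal.ofReal ((T x - a) ^ 2) ∂P +
      ∫⁻ x, ENNReal.ofReal ((T x - b) ^ 2) ∂(P.withDensity l) := by
  have hmb : Measurable fun x => ENNReal.ofReal ((T x - b) ^ 2) := by fun_prop
  have hma : Measurable fun x => ENNReal.ofReal ((T x - a) ^ 2) := by fun_prop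
  rw [lintegral_withDensity_eq_lintegral_mul _ hl hmb]
  have hone : ∫⁻ x, l x ∂P = 1 := by
    rwa [withDensity_apply _ MeasurableSet.univ, Measure.restrict_univ] at hprob
  have key : ∀ x, ENNReal.ofReal ((a - b) ^ 2) * l x ≤
      2 * (ENNReal.ofReal ((T x - a) ^ 2) + l x * ENNReal.ofReal ((T x - b) ^ 2)) +
        ENNReal.ofReal ((a - b) ^ 2 / 4) * l x ^ 2 := by
    intro x
    obtain ⟨r, hr⟩ : ∃ r : NNReal, l x = r := ⟨(l x).toNNReal, (ENNReal.coe_toNNReal (hfin x)).symm⟩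
    have h := ENNReal.ofReal_le_ofReal (sq_sub_mul_le_of_ratio (T x) a b r r.coe_nonneg)
    have h2 : (2 : ENNReal) = ENNReal.ofReal 2 := by simp
    have hr' : l x = ENNReal.ofReal r := by rw [hr, ENNReal.ofReal_coe_nnreal]
    rw [hr', h2, ← ENNReal.ofReal_pow r.coe_nonneg, ← ENNReal.ofReal_mul (by positivity),
      ← ENNReal.ofReal_mul r.coe_nonneg, ← ENNReal.ofReal_add (by positivity) (by positivity),
      ← ENNReal.ofReal_mul (by positivity), ← ENNReal.ofReal_mul (by positivity),
      ← ENNReal.ofReal_add (by positivity) (by positivity)]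
    exact h
  have hint := lintegral_mono (μ := P) key
  rw [lintegral_const_mul _ hl, lintegral_add_right _ ((hl.pow_const 2).const_mul _),
    lintegral_const_mul _ (by fun_prop), lintegral_const_mul _ (hl.pow_const 2),
    lintegral_add_left hma, hone, mul_one] at hint
  set A := ∫⁻ x, ENNReal.ofReal ((T x - a) ^ 2) ∂P
  set B := ∫⁻ x, l x * ENNReal.ofReal ((T x - b) ^ 2) ∂P with hB
  change _ ≤ A + B
  rcases eq_or_ne (A + B) ⊤ with htop | htop
  · rw [htop]; exact le_top
  have hint' : ENNReal.ofReal ((a - b) ^ 2) ≤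
      2 * (A + B) + ENNReal.ofReal ((a - b) ^ 2 / 4) * 2 := hint.trans (by gcongr)
  rw [ENNReal.ofReal_le_iff_le_toReal (ENNReal.add_ne_top.2
    ⟨ENNReal.mul_ne_top (by simp) htop, ENNReal.mul_ne_top (by simp) (by simp)⟩),
    ENNReal.toReal_add (ENNReal.mul_ne_top (by simp) htop) (ENNReal.mul_ne_top (by simp) (by simp)),
    ENNReal.toReal_mul, ENNReal.toReal_mul, ENNReal.toReal_ofReal (by positivity)] at hint'
  rw [ENNReal.ofReal_le_iff_le_toReal htop]
  simp only [ENNReal.toReal_ofNat] at hint'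
  linarith

/-! ### Estimation lower bound over hyperrectangles -/

theorem sum_sq_le_of_estimator_signs {D n : ℕ} {δ : ℝ}
    {est : (Fin n → Fin D → ℝ) → Fin D → ℝ} (hest : Measurable est) {τ : Fin D → ℝ}
    (hτ : ∀ i, n * τ i ^ 2 ≤ 1 / 8)
    (hrisk : ∀ s : Fin D → ℝ, (∀ i, s i = 1 ∨ s i = -1) →
      ∫⁻ x, ENNReal.ofReal (∑ i, (est x i - s i * τ i) ^ 2)
        ∂iidSamples n (gaussPi fun i => s i * τ i) ≤ ENNReal.ofReal (δ ^ 2)) :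
    ∑ i, τ i ^ 2 ≤ 2 * δ ^ 2 := by
  let vtx : (Fin D → Bool) → Fin D → ℝ := fun s i => (if s i then 1 else -1) * τ i
  let flip : Fin D → (Fin D → Bool) → (Fin D → Bool) := fun i s => Function.update s i (!s i)
  let r : Fin D → (Fin D → Bool) → ENNReal := fun i s =>
    ∫⁻ x, ENNReal.ofReal ((est x i - vtx s i) ^ 2) ∂iidSamples n (gaussPi (vtx s))
  have hflip : ∀ i, Function.Involutive (flip i) := by
    intro i s
    ext j
    rcases eq_or_ne j i with rfl | h <;> simp_all [flip]
  have hsum : ∀ s, ∑ i, r i s ≤ ENNReal.ofReal (δ ^ 2) := by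
    intro s
    have h := hrisk (fun i => if s i then 1 else -1) fun i => by by_cases hs : s i <;> simp [hs]
    simp_rw [ENNReal.ofReal_sum_of_nonneg fun _ _ => sq_nonneg _] at h
    rwa [lintegral_finsetSum _ fun i _ => by fun_prop] at h
  have hpair : ∀ i s, ENNReal.ofReal (τ i ^ 2) ≤ r i s + r i (flip i s) := by
    intro i s
    set d : Fin D → ℝ := Pi.single i (-2 * vtx s i) with hd
    have hvtx : vtx (flip i s) = vtx s + d := by
      ext j
      rcases eq_or_ne j i with rfl | h
      · by_cases hs : s j <;> simp [vtx, flip, hd, hs] <;> ring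
      · simp [vtx, flip, hd, h]
    have hsqv : vtx s i ^ 2 = τ i ^ 2 := by by_cases hs : s i <;> simp [vtx, hs]
    have hdsum : ∑ j, d j ^ 2 = 4 * τ i ^ 2 := by
      rw [Finset.sum_eq_single i (fun j _ hj => by simp [hd, hj]) (by simp)]
      simp only [hd, Pi.single_eq_same]
      rw [← hsqv]; ring
    have hdi : d i = -2 * vtx s i := by simp [hd]
    have hexp : rexp (n * (4 * τ i ^ 2)) ≤ 2 := by
      rw [← Real.exp_log (zero_lt_two' ℝ)]
      apply Real.exp_le_exp.2
      have := Real.log_two_gt_d9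
      linarith [hτ i]
    have h := two_point_lower_bound (iidSamples n (gaussPi (vtx s)))
      (measurable_sampleRatio n (vtx s) d)
      (fun x => ENNReal.prod_ne_top fun _ _ => ENNReal.prod_ne_top fun _ _ => ENNReal.ofReal_ne_top)
      (by rw [iidSamples_withDensity]; exact measure_univ)
      (by
        rw [lintegral_sampleRatio_sq, hdsum]
        exact (ENNReal.ofReal_le_ofReal hexp).trans (by simp))
      (T := fun x => est x i) (by fun_prop) (vtx s i) (vtx (flip i s) i)
    rw [iidSamples_withDensity, ← hvtx] at h
    refine le_trans (le_of_eq ?_) h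
    rw [hvtx, Pi.add_apply, hdi, ← hsqv]
    congr 1; ring
  have hdouble : ∀ i, ∑ s, (r i s + r i (flip i s)) = 2 * ∑ s, r i s := by
    intro i
    rw [Finset.sum_add_distrib, two_mul]
    congr 1
    exact Equiv.sum_comp (hflip i).toPerm (r i)
  have hcard : (Fintype.card (Fin D → Bool) : ENNReal) * ∑ i, ENNReal.ofReal (τ i ^ 2) ≤
      (Fintype.card (Fin D → Bool) : ENNReal) * (2 * ENNReal.ofReal (δ ^ 2)) := by
    calc (Fintype.card (Fin D → Bool) : ENNReal) * ∑ i, ENNReal.ofReal (τ i ^ 2)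
        = ∑ i, ∑ _s : Fin D → Bool, ENNReal.ofReal (τ i ^ 2) := by
          simp [Finset.mul_sum]
      _ ≤ ∑ i, ∑ s, (r i s + r i (flip i s)) :=
          Finset.sum_le_sum fun i _ => Finset.sum_le_sum fun s _ => hpair i s
      _ = 2 * ∑ s, ∑ i, r i s := by
          simp_rw [hdouble]
          rw [← Finset.mul_sum, Finset.sum_comm]
      _ ≤ 2 * ∑ _s : Fin D → Bool, ENNReal.ofReal (δ ^ 2) := by
          gcongr with s
          exact hsum s
      _ = _ := by
          rw [Finset.sum_const, nsmul_eq_mul, Finset.card_univ]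
          ring
  have hle := (ENNReal.mul_le_mul_iff_right (by simp) (by simp)).1 hcard
  rw [← ENNReal.ofReal_sum_of_nonneg fun _ _ => sq_nonneg _, show (2 : ENNReal) = ENNReal.ofReal 2 by
    simp, ← ENNReal.ofReal_mul zero_le_two] at hle
  exact (ENNReal.ofReal_le_ofReal_iff (by positivity)).1 hle

theorem Orthosymmetric.update_mem {D : ℕ} {Γ : Set (Fin D → ℝ)} (hΓ : Orthosymmetric Γ)
    (hconv : Convex ℝ Γ) {θ : Fin D → ℝ} (hθ : θ ∈ Γ) {i : Fin D} {c : ℝ} (hc : |c| ≤ |θ i|) :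
    Function.update θ i c ∈ Γ := by
  rcases eq_or_ne (θ i) 0 with h0 | h0
  · rw [h0, abs_zero, abs_nonpos_iff] at hc
    rw [hc, ← h0, Function.update_eq_self]
    exact hθ
  have hneg := hΓ θ hθ (Function.update 1 i (-1)) fun j => by
    rcases eq_or_ne j i with rfl | h <;> simp_all
  have hratio : |c / θ i| ≤ 1 := by
    rw [abs_div]; exact div_le_one_of_le₀ hc (abs_nonneg _)
  rw [abs_le] at hratio
  have := hconv hθ hneg (a := (1 + c / θ i) / 2) (b := (1 - c / θ i) / 2) (by linarith)
    (by linarith) (by ring)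
  convert this using 1
  ext j
  rcases eq_or_ne j i with rfl | h
  · simp
    field_simp
    ring
  · simp [h]
    ring

theorem Orthosymmetric.mem_of_abs_le {D : ℕ} {Γ : Set (Fin D → ℝ)} (hΓ : Orthosymmetric Γ)
    (hconv : Convex ℝ Γ) {θ η : Fin D → ℝ} (hθ : θ ∈ Γ) (h : ∀ i, |η i| ≤ |θ i|) : η ∈ Γ := by
  have key : ∀ S : Finset (Fin D), (fun i => if i ∈ S then η i else θ i) ∈ Γ := by
    intro S
    induction S using Finset.induction_on with
    | empty => simpa using hθ
    | insert i S hi ih =>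
      have := hΓ.update_mem hconv ih (i := i) (c := η i) (by simpa [hi] using h i)
      convert this using 1
      ext j
      rcases eq_or_ne j i with rfl | hj <;> simp_all
  simpa using key Finset.univ

theorem sum_sq_le_of_estimator {D n : ℕ} {Γ : Set (Fin D → ℝ)} (hΓ : Orthosymmetric Γ)
    (hconv : Convex ℝ Γ) {δ : ℝ} {est : (Fin n → Fin D → ℝ) → Fin D → ℝ} (hest : Measurable est)
    (hrisk : ∀ θ ∈ Γ, ∫⁻ x, ENNReal.ofReal (∑ i, (est x i - θ i) ^ 2) ∂iidSamples n (gaussPi θ)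
      ≤ ENNReal.ofReal (δ ^ 2))
    {θ τ : Fin D → ℝ} (hθ : θ ∈ Γ) (hle : ∀ i, τ i ^ 2 ≤ θ i ^ 2)
    (hτ : ∀ i, n * τ i ^ 2 ≤ 1 / 8) :
    ∑ i, τ i ^ 2 ≤ 2 * δ ^ 2 := by
  refine sum_sq_le_of_estimator_signs hest hτ fun s hs =>
    hrisk _ (hΓ _ (hΓ.mem_of_abs_le hconv hθ fun i => sq_le_sq.1 (hle i)) s hs)

/-! ### Shrinkage weights from quadratic convexity -/

/-- Minimax linear shrinkage: if every element `t` of a compact convex set of squared signals has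
`∑ min (t i) v ≤ R`, then a single choice of shrinkage weights has linear risk at most `R`. -/
theorem exists_shrinkage_weights {D : ℕ} {T : Set (Fin D → ℝ)} (hcomp : IsCompact T)
    (hconv : Convex ℝ T) (hne : T.Nonempty) (hpos : ∀ t ∈ T, ∀ i, 0 ≤ t i) {v R : ℝ} (hv : 0 < v)
    (hR : ∀ t ∈ T, ∑ i, min (t i) v ≤ R) :
    ∃ w : Fin D → ℝ, (∀ i, 0 ≤ w i ∧ w i ≤ 1) ∧
      ∀ t ∈ T, ∑ i, (1 - w i) ^ 2 * t i + v * ∑ i, w i ^ 2 ≤ R := by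
  obtain ⟨u, hu, hmax⟩ := hcomp.exists_isMaxOn (f := fun t => ∑ i, v * t i / (v + t i)) hne
    (continuousOn_finsetSum _ fun i _ => ContinuousOn.div (by fun_prop) (by fun_prop)
      fun t ht => by linarith [hpos t ht i])
  have hu0 := hpos u hu
  have hvu : ∀ i, 0 < v + u i := fun i => by linarith [hu0 i]
  refine ⟨fun i => u i / (v + u i), fun i => ⟨div_nonneg (hu0 i) (hvu i).le,
    div_le_one_of_le₀ (by linarith) (hvu i).le⟩, fun t ht => ?_⟩
  have hfirst : ∑ i, v ^ 2 * (t i - u i) / ((v + u i) * (v + u i)) ≤ 0 := by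
    have hcont : Filter.Tendsto (fun l : ℝ => ∑ i, v ^ 2 * (t i - u i) /
        ((v + u i) * (v + (u i + l * (t i - u i))))) (nhdsWithin 0 (Set.Ioi 0))
        (nhds (∑ i, v ^ 2 * (t i - u i) / ((v + u i) * (v + u i)))) := by
      refine tendsto_nhdsWithin_of_tendsto_nhds ?_
      refine tendsto_finsetSum _ fun i _ => ?_
      have : ContinuousAt (fun l : ℝ => v ^ 2 * (t i - u i) /
          ((v + u i) * (v + (u i + l * (t i - u i))))) 0 :=
        ContinuousAt.div (by fun_prop) (by fun_prop) (by simp [(hvu i).ne'])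
      simpa [ContinuousAt] using this
    refine le_of_tendsto hcont ?_
    filter_upwards [Ioo_mem_nhdsGT (zero_lt_one' ℝ)] with l hl
    have hmem : (fun i => u i + l * (t i - u i)) ∈ T := by
      have := hconv hu ht (a := 1 - l) (b := l) (by linarith [hl.2]) hl.1.le (by ring)
      convert this using 1
      ext i
      simp
      ring
    have h := hmax hmem
    simp only [Set.mem_ofPred_eq] at h
    have hdiff : ∑ i, v * (u i + l * (t i - u i)) / (v + (u i + l * (t i - u i))) -
        ∑ i, v * u i / (v + u i) =
        l * ∑ i, v ^ 2 * (t i - u i) / ((v + u i) * (v + (u i + l * (t i - u i)))) := by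
      rw [← Finset.sum_sub_distrib, Finset.mul_sum]
      refine Finset.sum_congr rfl fun i _ => ?_
      have h1 := (hvu i).ne'
      have h2 : v + (u i + l * (t i - u i)) ≠ 0 := by
        have : 0 ≤ u i + l * (t i - u i) := hpos _ hmem i
        linarith
      field_simp
      ring
    have := hl.1
    by_contra hcon
    push Not at hcon
    nlinarith [mul_pos this hcon]
  have hrisk : ∑ i, (1 - u i / (v + u i)) ^ 2 * t i + v * ∑ i, (u i / (v + u i)) ^ 2 =
      ∑ i, v * u i / (v + u i) + ∑ i, v ^ 2 * (t i - u i) / ((v + u i) * (v + u i)) := by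
    rw [Finset.mul_sum, ← Finset.sum_add_distrib, ← Finset.sum_add_distrib]
    refine Finset.sum_congr rfl fun i _ => ?_
    have h1 := (hvu i).ne'
    field_simp
    ring
  have hmin : ∑ i, v * u i / (v + u i) ≤ ∑ i, min (u i) v := by
    refine Finset.sum_le_sum fun i _ => le_min ?_ ?_ <;> rw [div_le_iff₀ (hvu i)] <;>
      nlinarith [hu0 i]
  linarith [hR u hu]

/-! ### Law of the sample mean -/

theorem pi_gaussianReal_map_sum {ι : Type*} [Fintype ι] [DecidableEq ι] (p : ℝ) (S : Finset ι) :
    (Measure.pi fun _ : ι => gaussianReal p 1).map (fun x => ∑ k ∈ S, x k) =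
      gaussianReal (S.card * p) S.card := by
  have hind : iIndepFun (fun k (x : ι → ℝ) => x k) (Measure.pi fun _ : ι => gaussianReal p 1) :=
    iIndepFun_pi (X := fun _ => id) fun _ => aemeasurable_id
  induction S using Finset.induction_on with
  | empty => simp [Measure.map_const]
  | insert k S hk ih =>
    have hadd := gaussianReal_add_gaussianReal_of_indepFun
      (X := fun x : ι → ℝ => x k) (Y := fun x : ι → ℝ => ∑ j ∈ S, x j)
      (by
        have := (hind.indepFun_finsetSum_of_notMem (fun j => measurable_pi_apply j) hk).symm
        convert this using 1
        ext x
        simp)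
      (measurePreserving_eval (fun _ : ι => gaussianReal p 1) k).map_eq ih
    have hfun : (fun x : ι → ℝ => ∑ j ∈ insert k S, x j) =
        (fun x : ι → ℝ => x k) + fun x => ∑ j ∈ S, x j := by
      ext x
      simp [Finset.sum_insert hk]
    rw [hfun, hadd, Finset.card_insert_of_notMem hk]
    push_cast
    congr 1 <;> ring

theorem pi_gaussianReal_map_mean {n : ℕ} (hn : 0 < n) (p : ℝ) :
    (Measure.pi fun _ : Fin n => gaussianReal p 1).map (fun x => (∑ k, x k) / (n : ℝ)) =
      gaussianReal p (n : NNReal)⁻¹ := by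
  have hn' : (n : NNReal) ≠ 0 := by exact_mod_cast hn.ne'
  have hn'' : (n : ℝ) ≠ 0 := by exact_mod_cast hn.ne'
  have hcomp : (fun x : Fin n → ℝ => (∑ k, x k) / (n : ℝ)) =
      (fun s : ℝ => s / n) ∘ fun x => ∑ k, x k := rfl
  rw [hcomp, ← Measure.map_map (by fun_prop) (by fun_prop), pi_gaussianReal_map_sum,
    gaussianReal_map_div_const]
  congr 1
  · simp; field_simp
  · rw [← NNReal.coe_inj]
    simp; field_simp

theorem pi_pi_map_flip {ι κ : Type*} [Fintype ι] [Fintype κ] (μ : κ → Measure ℝ)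
    [∀ j, IsProbabilityMeasure (μ j)] :
    (Measure.pi fun _ : ι => Measure.pi μ).map (fun x j k => x k j) =
      Measure.pi fun j : κ => Measure.pi fun _ : ι => μ j := by
  symm
  refine Measure.pi_eq_generateFrom
    (C := fun _ => Set.pi Set.univ '' Set.pi Set.univ fun _ : ι => {s : Set ℝ | MeasurableSet s})
    (fun _ => generateFrom_pi) (fun _ => isPiSystem_pi)
    (fun j => ⟨fun _ => Set.univ, fun _ => ⟨fun _ => Set.univ, by simp, by simp⟩,
      fun _ => by simp, Set.iUnion_const _⟩) fun s hs => ?_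
  choose t ht hts using hs
  have hmeas : ∀ j k, MeasurableSet (t j k) := fun j k => ht j k trivial
  have hpre : (fun (x : ι → κ → ℝ) j k => x k j) ⁻¹' Set.univ.pi s =
      Set.univ.pi fun k => Set.univ.pi fun j => t j k := by
    ext x
    simp only [Set.mem_preimage, Set.mem_pi, Set.mem_univ, forall_const, ← hts]
    exact ⟨fun h k j => h j k, fun h j k => h k j⟩
  rw [Measure.map_apply (by fun_prop) (MeasurableSet.univ_pi fun j => by
    rw [← hts]; exact MeasurableSet.univ_pi (hmeas j)), hpre]
  simp_rw [← hts, Measure.pi_pi]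
  exact Finset.prod_comm

/-- The sample mean of `n` vectors. -/
noncomputable def sampleMean {D : ℕ} (n : ℕ) (x : Fin n → Fin D → ℝ) (i : Fin D) : ℝ :=
  (∑ k, x k i) / n

theorem measurePreserving_sampleMean {D n : ℕ} (hn : 0 < n) (θ : Fin D → ℝ) :
    MeasurePreserving (sampleMean n) (iidSamples n (gaussPi θ))
      (Measure.pi fun i => gaussianReal (θ i) (n : NNReal)⁻¹) := by
  have hm : Measurable (sampleMean n : (Fin n → Fin D → ℝ) → Fin D → ℝ) := by
    unfold sampleMean; fun_prop
  refine ⟨hm, ?_⟩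
  have hcomp : (sampleMean n : (Fin n → Fin D → ℝ) → Fin D → ℝ) =
      (fun y i => (∑ k, y i k) / (n : ℝ)) ∘ fun x j k => x k j := rfl
  unfold iidSamples gaussPi
  rw [hcomp, ← Measure.map_map (by fun_prop) (by fun_prop), pi_pi_map_flip,
    Measure.pi_map_pi (f := fun _ (y : Fin n → ℝ) => (∑ k, y k) / (n : ℝ)) fun i => by fun_prop]
  simp_rw [pi_gaussianReal_map_mean hn]

/-! ### Moments of the Gaussian distribution -/

theorem integrable_sub_pow_gaussianReal (p : ℝ) (v : NNReal) (k : ℕ) :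
    Integrable (fun x => (x - p) ^ k) (gaussianReal p v) := by
  have h := (memLp_id_gaussianReal' (μ := p) (v := v) k (by simp)).sub (memLp_const p)
  have := h.integrable_norm_pow'
  refine (this.mono' (by fun_prop) (ae_of_all _ fun x => ?_))
  simp

theorem integral_sub_gaussianReal (p : ℝ) (v : NNReal) : ∫ x, (x - p) ∂gaussianReal p v = 0 := by
  have h : Integrable (fun x => x) (gaussianReal p v) :=
    (memLp_id_gaussianReal' 1 (by simp)).integrable le_rfl
  rw [integral_sub h (integrable_const p)]
  simp [integral_id_gaussianReal]

theorem integral_sub_sq_gaussianReal (p : ℝ) (v : NNReal) :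
    ∫ x, (x - p) ^ 2 ∂gaussianReal p v = v := by
  have h := variance_fun_id_gaussianReal (μ := p) (v := v)
  rwa [variance_eq_integral (by fun_prop), integral_id_gaussianReal] at h

theorem integral_sub_pow_four_gaussianReal_le (p : ℝ) {v : NNReal} (hv : v ≠ 0) :
    ∫ x, (x - p) ^ 4 ∂gaussianReal p v ≤ 80 * (v : ℝ) ^ 2 := by
  have hv' : (0 : ℝ) < v := by exact_mod_cast pos_iff_ne_zero.2 hv
  set t : ℝ := (√v)⁻¹ with ht
  have ht2 : t ^ 2 = (v : ℝ)⁻¹ := by rw [ht, inv_pow, Real.sq_sqrt hv'.le]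
  have hpt : ∀ x : ℝ, (x - p) ^ 4 ≤ 24 * (v : ℝ) ^ 2 *
      (rexp (-(t * p)) * rexp (t * x) + rexp (t * p) * rexp (-t * x)) := by
    intro x
    have h1 := Real.pow_div_factorial_le_exp (|t * (x - p)|) (abs_nonneg _) 4
    have h2 : rexp |t * (x - p)| ≤ rexp (t * (x - p)) + rexp (-(t * (x - p))) := by
      rcases abs_cases (t * (x - p)) with h | h <;> rw [h.1] <;>
        linarith [exp_pos (t * (x - p)), exp_pos (-(t * (x - p)))]
    have h3 : |t * (x - p)| ^ 4 = (x - p) ^ 4 / (v : ℝ) ^ 2 := by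
      rw [show 4 = 2 * 2 by rfl, pow_mul, sq_abs, mul_pow, ht2]
      field_simp
    rw [h3] at h1
    rw [← Real.exp_add, ← Real.exp_add]
    have h4 : (x - p) ^ 4 / (v : ℝ) ^ 2 ≤ 24 * (rexp (t * (x - p)) + rexp (-(t * (x - p)))) := by
      rw [show ((Nat.factorial 4 : ℕ) : ℝ) = 24 by norm_num [Nat.factorial]] at h1
      linarith
    rw [div_le_iff₀ (by positivity)] at h4
    calc (x - p) ^ 4 ≤ _ := h4
      _ = _ := by ring_nf
  have hmgf : ∀ s : ℝ, ∫ x, rexp (s * x) ∂gaussianReal p v = rexp (p * s + v * s ^ 2 / 2) :=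
    fun s => congrFun (mgf_id_gaussianReal (μ := p) (v := v)) s
  have hI := fun s => integrable_exp_mul_gaussianReal (μ := p) (v := v) s
  refine (integral_mono (integrable_sub_pow_gaussianReal p v 4)
    ((((hI t).const_mul _).add ((hI (-t)).const_mul _)).const_mul _) hpt).trans ?_
  simp only [Pi.add_apply]
  rw [integral_const_mul, integral_add ((hI t).const_mul _) ((hI (-t)).const_mul _),
    integral_const_mul, integral_const_mul, hmgf, hmgf, ← Real.exp_add, ← Real.exp_add, neg_sq, ht2,
    mul_inv_cancel₀ hv'.ne']
  rw [show -(t * p) + (p * t + 1 / 2) = 1 / 2 by ring,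
    show t * p + (p * -t + 1 / 2) = 1 / 2 by ring]
  have hexp : rexp (1 / 2) ≤ 5 / 3 := by
    have h : rexp (1 / 2) ^ 2 = rexp 1 := by rw [← Real.exp_nat_mul]; norm_num
    nlinarith [Real.exp_one_lt_d9, exp_pos (1 / 2 : ℝ)]
  nlinarith [sq_nonneg (v : ℝ)]

/-! ### Mean and variance of the test statistic in one coordinate -/

section Coordinate

variable (p q r : ℝ) (v u : NNReal)

/-- The joint law of the three sample means in one coordinate. -/
noncomputable def coordLaw : Measure (ℝ × ℝ × ℝ) :=
  (gaussianReal p v).prod ((gaussianReal q v).prod (gaussianReal r u))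

instance isProbabilityMeasure_coordLaw : IsProbabilityMeasure (coordLaw p q r v u) := by
  unfold coordLaw; infer_instance

/-- Centred monomials in the three sample means. -/
def centredMonomial (a b c : ℕ) (w : ℝ × ℝ × ℝ) : ℝ :=
  (w.1 - p) ^ a * ((w.2.1 - q) ^ b * (w.2.2 - r) ^ c)

theorem integrable_centredMonomial (a b c : ℕ) :
    Integrable (centredMonomial p q r a b c) (coordLaw p q r v u) :=
  (integrable_sub_pow_gaussianReal p v a).mul_prod
    ((integrable_sub_pow_gaussianReal q v b).mul_prod (integrable_sub_pow_gaussianReal r u c))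

theorem integral_centredMonomial (a b c : ℕ) :
    ∫ w, centredMonomial p q r a b c w ∂coordLaw p q r v u =
      (∫ x, (x - p) ^ a ∂gaussianReal p v) *
        ((∫ x, (x - q) ^ b ∂gaussianReal q v) * ∫ x, (x - r) ^ c ∂gaussianReal r u) := by
  unfold centredMonomial coordLaw
  rw [integral_prod_mul (fun x => (x - p) ^ a)
    (fun w : ℝ × ℝ => (w.1 - q) ^ b * (w.2 - r) ^ c),
    integral_prod_mul (fun x => (x - q) ^ b) (fun x => (x - r) ^ c)]

/-- One coordinate of the test statistic. -/
def coordStat (w : ℝ × ℝ × ℝ) : ℝ := (w.1 - w.2.2) ^ 2 - (w.2.1 - w.2.2) ^ 2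

theorem measurable_coordStat : Measurable coordStat := by
  unfold coordStat; fun_prop

theorem integral_coordStat :
    ∫ w, coordStat w ∂coordLaw p q r v u = (p - r) ^ 2 - (q - r) ^ 2 := by
  have hI := integrable_centredMonomial p q r v u
  have hexpand : coordStat = fun w => ((p - r) ^ 2 - (q - r) ^ 2) + (
      (centredMonomial p q r 2 0 0 w - centredMonomial p q r 0 2 0 w) + (
      (-2 * centredMonomial p q r 1 0 1 w + 2 * centredMonomial p q r 0 1 1 w) + (
      (2 * (p - r) * centredMonomial p q r 1 0 0 w +
        -2 * (q - r) * centredMonomial p q r 0 1 0 w) +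
      -2 * (p - q) * centredMonomial p q r 0 0 1 w))) := by
    ext w
    simp only [coordStat, centredMonomial]
    ring
  rw [hexpand, integral_add (integrable_const _) (by fun_prop), integral_add (by fun_prop)
    (by fun_prop), integral_add (by fun_prop) (by fun_prop), integral_add (by fun_prop)
    (by fun_prop), integral_add (by fun_prop) (by fun_prop), integral_add (by fun_prop)
    (by fun_prop), integral_sub (hI 2 0 0) (hI 0 2 0)]
  simp only [integral_const_mul, integral_centredMonomial, pow_one, pow_zero,
    integral_sub_gaussianReal, integral_sub_sq_gaussianReal]
  simp

/-- A sum of monomials dominating the squared fluctuation of `coordStat`. -/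
def coordDominator (w : ℝ × ℝ × ℝ) : ℝ :=
  6 * ((centredMonomial p q r 4 0 0 w + centredMonomial p q r 0 4 0 w) + (
    (4 * centredMonomial p q r 2 0 2 w + 4 * centredMonomial p q r 0 2 2 w) + (
    (4 * (p - r) ^ 2 * centredMonomial p q r 2 0 0 w +
      4 * (q - r) ^ 2 * centredMonomial p q r 0 2 0 w) +
    4 * (p - q) ^ 2 * centredMonomial p q r 0 0 2 w)))

theorem sq_coordStat_sub_le (w : ℝ × ℝ × ℝ) :
    (coordStat w - ((p - r) ^ 2 - (q - r) ^ 2)) ^ 2 ≤ coordDominator p q r w := by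
  obtain ⟨x, y, z⟩ := w
  simp only [coordStat, coordDominator, centredMonomial, pow_zero, mul_one, one_mul]
  set X := x - p with hX
  set Y := y - q with hY
  set Z := z - r with hZ
  set a := p - r with ha
  set b := q - r with hb
  have hexpand : (x - z) ^ 2 - (y - z) ^ 2 - (a ^ 2 - b ^ 2) =
      (X ^ 2 - Y ^ 2) + (-2 * (X * Z)) + 2 * (Y * Z) + 2 * a * X + (-2 * b * Y) +
        (-2 * (p - q) * Z) := by
    rw [hX, hY, hZ, ha, hb]; ring
  have hsix : ∀ e₁ e₂ e₃ e₄ e₅ e₆ : ℝ, (e₁ + e₂ + e₃ + e₄ + e₅ + e₆) ^ 2 ≤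
      6 * (e₁ ^ 2 + e₂ ^ 2 + e₃ ^ 2 + e₄ ^ 2 + e₅ ^ 2 + e₆ ^ 2) := by
    intro e₁ e₂ e₃ e₄ e₅ e₆
    nlinarith [sq_nonneg (e₁ - e₂), sq_nonneg (e₁ - e₃), sq_nonneg (e₁ - e₄), sq_nonneg (e₁ - e₅),
      sq_nonneg (e₁ - e₆), sq_nonneg (e₂ - e₃), sq_nonneg (e₂ - e₄), sq_nonneg (e₂ - e₅),
      sq_nonneg (e₂ - e₆), sq_nonneg (e₃ - e₄), sq_nonneg (e₃ - e₅), sq_nonneg (e₃ - e₆),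
      sq_nonneg (e₄ - e₅), sq_nonneg (e₄ - e₆), sq_nonneg (e₅ - e₆)]
  rw [hexpand]
  refine (hsix _ _ _ _ _ _).trans ?_
  nlinarith [mul_nonneg (sq_nonneg X) (sq_nonneg Y)]

theorem integrable_coordDominator :
    Integrable (coordDominator p q r) (coordLaw p q r v u) := by
  have hI := integrable_centredMonomial p q r v u
  unfold coordDominator
  fun_prop

theorem integral_coordDominator_le (hv : v ≠ 0) :
    ∫ w, coordDominator p q r w ∂coordLaw p q r v u ≤
      960 * (v : ℝ) ^ 2 + 48 * (v * u) + 24 * ((p - r) ^ 2 + (q - r) ^ 2) * v +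
        24 * (p - q) ^ 2 * u := by
  have hI := integrable_centredMonomial p q r v u
  unfold coordDominator
  rw [integral_const_mul, integral_add (by fun_prop)
    (by fun_prop), integral_add (by fun_prop) (by fun_prop), integral_add (by fun_prop)
    (by fun_prop), integral_add (by fun_prop) (by fun_prop), integral_add (by fun_prop)
    (by fun_prop), integral_add (by fun_prop) (by fun_prop)]
  simp_rw [integral_const_mul, integral_centredMonomial, pow_zero, integral_sub_sq_gaussianReal]
  have h1 := integral_sub_pow_four_gaussianReal_le p hv
  have h2 := integral_sub_pow_four_gaussianReal_le q hv
  simp only [integral_const, probReal_univ, smul_eq_mul, mul_one, one_mul]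
  linarith

theorem memLp_coordStat : MemLp coordStat 2 (coordLaw p q r v u) := by
  have h : MemLp (fun w => coordStat w - ((p - r) ^ 2 - (q - r) ^ 2)) 2 (coordLaw p q r v u) := by
    have hm : Measurable fun w => coordStat w - ((p - r) ^ 2 - (q - r) ^ 2) :=
      measurable_coordStat.sub_const _
    rw [memLp_two_iff_integrable_sq hm.aestronglyMeasurable]
    refine (integrable_coordDominator p q r v u).mono' (hm.pow_const 2).aestronglyMeasurable
      (ae_of_all _ fun w => ?_)
    rw [Real.norm_eq_abs, abs_of_nonneg (sq_nonneg _)]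
    exact sq_coordStat_sub_le p q r w
  convert h.add (memLp_const ((p - r) ^ 2 - (q - r) ^ 2)) using 1
  ext w
  simp

theorem variance_coordStat_le (hv : v ≠ 0) :
    Var[coordStat; coordLaw p q r v u] ≤
      960 * (v : ℝ) ^ 2 + 48 * (v * u) + 24 * ((p - r) ^ 2 + (q - r) ^ 2) * v +
        24 * (p - q) ^ 2 * u := by
  rw [variance_eq_integral measurable_coordStat.aemeasurable, integral_coordStat]
  refine le_trans (integral_mono_of_nonneg (ae_of_all _ fun _ => sq_nonneg _)
    (integrable_coordDominator p q r v u) (ae_of_all _ fun w => sq_coordStat_sub_le p q r w))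
    (integral_coordDominator_le p q r v u hv)

end Coordinate

/-! ### The likelihood-free test -/

/-- The weighted difference of squared distances of the real sample mean to the simulated ones. -/
noncomputable def lfhtStat {D : ℕ} (a : Fin D → ℝ) (m n : ℕ)
    (w : (Fin n → Fin D → ℝ) × (Fin n → Fin D → ℝ) × (Fin m → Fin D → ℝ)) : ℝ :=
  ∑ i, a i * coordStat (sampleMean n w.1 i, sampleMean n w.2.1 i, sampleMean m w.2.2 i)

theorem measurable_lfhtStat {D : ℕ} (a : Fin D → ℝ) (m n : ℕ) : Measurable (lfhtStat a m n) := by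
  unfold lfhtStat coordStat sampleMean; fun_prop

theorem lfhtStat_deviation {D m n : ℕ} (hm : 0 < m) (hn : 0 < n) (a θ₁ θ₂ θ : Fin D → ℝ) {c : ℝ}
    (hc : 0 < c)
    (hvar : ∑ i, a i ^ 2 * (960 * ((n : ℝ)⁻¹) ^ 2 + 48 * ((n : ℝ)⁻¹ * (m : ℝ)⁻¹) +
      24 * ((θ₁ i - θ i) ^ 2 + (θ₂ i - θ i) ^ 2) * (n : ℝ)⁻¹ +
        24 * (θ₁ i - θ₂ i) ^ 2 * (m : ℝ)⁻¹) ≤ c ^ 2 / 4) :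
    ((iidSamples n (gaussPi θ₁)).prod
      ((iidSamples n (gaussPi θ₂)).prod (iidSamples m (gaussPi θ))))
      {w | c ≤ |lfhtStat a m n w - ∑ i, a i * ((θ₁ i - θ i) ^ 2 - (θ₂ i - θ i) ^ 2)|} ≤ 1 / 4 := by
  set v : NNReal := (n : NNReal)⁻¹ with hv
  set u : NNReal := (m : NNReal)⁻¹ with hu
  have hv0 : v ≠ 0 := by rw [hv]; exact inv_ne_zero (by exact_mod_cast hn.ne')
  let μ : Measure (Fin D → ℝ × ℝ × ℝ) :=
    Measure.pi fun i => coordLaw (θ₁ i) (θ₂ i) (θ i) v u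
  have hmeans := (measurePreserving_sampleMean hn θ₁).prod
    ((measurePreserving_sampleMean hn θ₂).prod (measurePreserving_sampleMean hm θ))
  have hmerge := ((MeasurePreserving.id (Measure.pi fun i => gaussianReal (θ₁ i) v)).prod
    (measurePreserving_arrowProdEquivProdArrow ℝ ℝ (Fin D) (fun i => gaussianReal (θ₂ i) v)
      (fun i => gaussianReal (θ i) u))).comp
    (measurePreserving_arrowProdEquivProdArrow ℝ (ℝ × ℝ) (Fin D) (fun i => gaussianReal (θ₁ i) v)
      (fun i => (gaussianReal (θ₂ i) v).prod (gaussianReal (θ i) u)))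
  have hX : ∀ i, MemLp (fun w => a i * coordStat w) 2 (coordLaw (θ₁ i) (θ₂ i) (θ i) v u) :=
    fun i => (memLp_coordStat _ _ _ _ _).const_mul (a i)
  have hcoord : ∀ i, MemLp (fun w : Fin D → ℝ × ℝ × ℝ => a i * coordStat (w i)) 2 μ :=
    fun i => (hX i).comp_measurePreserving (measurePreserving_eval _ i)
  set S : (Fin D → ℝ × ℝ × ℝ) → ℝ := ∑ i, fun w => a i * coordStat (w i) with hS
  have hSmem : MemLp S 2 μ := memLp_finsetSum' _ fun i _ => hcoord i
  have hSint : ∫ w, S w ∂μ = ∑ i, a i * ((θ₁ i - θ i) ^ 2 - (θ₂ i - θ i) ^ 2) := by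
    simp only [hS, Finset.sum_apply]
    rw [integral_finsetSum _ fun i _ => (hcoord i).integrable one_le_two]
    refine Finset.sum_congr rfl fun i _ => ?_
    rw [integral_const_mul, ← integral_coordStat (θ₁ i) (θ₂ i) (θ i) v u]
    congr 1
    exact integral_comp_eval (μ := fun i => coordLaw (θ₁ i) (θ₂ i) (θ i) v u) (i := i)
      measurable_coordStat.aestronglyMeasurable
  have hSvar : Var[S; μ] ≤ c ^ 2 / 4 := by
    rw [hS, variance_sum_pi hX]
    refine le_trans (Finset.sum_le_sum fun i _ => ?_) hvar
    rw [variance_const_mul]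
    have := variance_coordStat_le (θ₁ i) (θ₂ i) (θ i) v u hv0
    simp only [hv, hu, NNReal.coe_inv, NNReal.coe_natCast] at this
    exact mul_le_mul_of_nonneg_left this (sq_nonneg _)
  have hSmeas : Measurable fun w : (Fin D → ℝ) × (Fin D → ℝ) × (Fin D → ℝ) =>
      ∑ i, a i * coordStat (w.1 i, w.2.1 i, w.2.2 i) := by
    unfold coordStat; fun_prop
  set c₁ := ∑ i, a i * ((θ₁ i - θ i) ^ 2 - (θ₂ i - θ i) ^ 2)
  have hset : MeasurableSet {w : (Fin D → ℝ) × (Fin D → ℝ) × (Fin D → ℝ) |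
      c ≤ |∑ i, a i * coordStat (w.1 i, w.2.1 i, w.2.2 i) - c₁|} :=
    measurableSet_le measurable_const (by fun_prop)
  have h1 := hmeans.measure_preimage hset.nullMeasurableSet
  have h2 := hmerge.measure_preimage hset.nullMeasurableSet
  have hcheb := meas_ge_le_variance_div_sq hSmem hc
  rw [hSint] at hcheb
  calc _ = _ := h1
    _ = _ := h2.symm
    _ = μ {w | c ≤ |S w - c₁|} := by
      congr 1
      ext w
      simp [hS, MeasurableEquiv.arrowProdEquivProdArrow, Equiv.arrowProdEquivProdArrow]
    _ ≤ _ := hcheb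
    _ ≤ ENNReal.ofReal (1 / 4) := by
      apply ENNReal.ofReal_le_ofReal
      rw [div_le_iff₀ (by positivity)]
      linarith
    _ = 1 / 4 := by
      rw [ENNReal.ofReal_div_of_pos (by norm_num)]
      simp

/-! ### Feasibility of estimation -/

theorem exists_estimator {D : ℕ} (Γ : Set (Fin D → ℝ)) {δ : ℝ} (hδ : 0 < δ) :
    ∃ n : ℕ, ∃ est : (Fin n → (Fin D → ℝ)) → (Fin D → ℝ), Measurable est ∧
    ∀ θ ∈ Γ,
      (∫⁻ x, ENNReal.ofReal (∑ i, (est x i - θ i) ^ 2) ∂(iidSamples n (gaussPi θ)))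
        ≤ ENNReal.ofReal (δ ^ 2) := by
  obtain ⟨n, hn⟩ := exists_nat_gt (D / δ ^ 2)
  have hn0 : (0 : ℝ) < n := lt_of_le_of_lt (by positivity) hn
  have hnpos : 0 < n := by exact_mod_cast hn0
  refine ⟨n, sampleMean n, by unfold sampleMean; fun_prop, fun θ _ => ?_⟩
  rw [(measurePreserving_sampleMean hnpos θ).lintegral_comp
    (f := fun y : Fin D → ℝ => ENNReal.ofReal (∑ i, (y i - θ i) ^ 2)) (by fun_prop)]
  simp_rw [ENNReal.ofReal_sum_of_nonneg fun _ _ => sq_nonneg _]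
  rw [lintegral_finsetSum _ fun i _ => by fun_prop]
  have hcoord : ∀ i, ∫⁻ y : Fin D → ℝ, ENNReal.ofReal ((y i - θ i) ^ 2)
      ∂(Measure.pi fun i => gaussianReal (θ i) (n : NNReal)⁻¹) = ENNReal.ofReal (n : ℝ)⁻¹ := by
    intro i
    rw [(measurePreserving_eval (fun i => gaussianReal (θ i) (n : NNReal)⁻¹) i).lintegral_comp
      (f := fun x => ENNReal.ofReal ((x - θ i) ^ 2)) (by fun_prop),
      ← ofReal_integral_eq_lintegral_ofReal (integrable_sub_pow_gaussianReal _ _ 2)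
        (ae_of_all _ fun _ => sq_nonneg _), integral_sub_sq_gaussianReal]
    simp
  simp_rw [hcoord]
  rw [← ENNReal.ofReal_sum_of_nonneg fun _ _ => by positivity]
  apply ENNReal.ofReal_le_ofReal
  rw [div_lt_iff₀ (by positivity)] at hn
  simp only [Finset.sum_const, Finset.card_univ, Fintype.card_fin, nsmul_eq_mul]
  rw [← div_eq_mul_inv, div_le_iff₀ hn0]
  linarith

theorem nEst_spec {D : ℕ} (Γ : Set (Fin D → ℝ)) {δ : ℝ} (hδ : 0 < δ) :
    ∃ est : (Fin (nEst Γ δ) → (Fin D → ℝ)) → (Fin D → ℝ), Measurable est ∧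
    ∀ θ ∈ Γ, (∫⁻ x, ENNReal.ofReal (∑ i, (est x i - θ i) ^ 2)
      ∂(iidSamples (nEst Γ δ) (gaussPi θ))) ≤ ENNReal.ofReal (δ ^ 2) :=
  Nat.sInf_mem (s := {n : ℕ | ∃ est : (Fin n → (Fin D → ℝ)) → (Fin D → ℝ), Measurable est ∧
    ∀ θ ∈ Γ, (∫⁻ x, ENNReal.ofReal (∑ i, (est x i - θ i) ^ 2) ∂(iidSamples n (gaussPi θ)))
        ≤ ENNReal.ofReal (δ ^ 2)}) (exists_estimator Γ hδ)

/-! ### Sample sizes -/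

theorem variance_budget {ε N m n S A B : ℝ} (hε : 0 < ε) (hm : 0 < m) (hn : 0 < n) (hN : 0 ≤ N)
    (hNε : 1 / 2 ≤ N * ε ^ 2) (hmε : 10000 / ε ^ 2 ≤ m) (hnε : 10000 * √N / ε ≤ n)
    (hmn : 10000 ^ 2 * N ^ 2 ≤ m * n) (hA : A ≤ N * ε ^ 2) (hB : B ≤ S) (hS : ε ^ 2 / 4 ≤ S) :
    A * (960 * n⁻¹ ^ 2 + 48 * (n⁻¹ * m⁻¹)) + 24 * B * (n⁻¹ + m⁻¹) ≤ S ^ 2 / 4 := by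
  have hS0 : 0 < S := lt_of_lt_of_le (by positivity) hS
  rw [div_le_iff₀ hε] at hnε
  rw [div_le_iff₀ (by positivity)] at hmε
  have hsq : √N ^ 2 = N := Real.sq_sqrt hN
  have hroot : 7 / 10 ≤ √N * ε := by
    refine le_of_sq_le_sq ?_ (by positivity)
    rw [mul_pow, hsq]; linarith
  have hn2 : 10000 ^ 2 * N ≤ (n * ε) ^ 2 := by
    have := pow_le_pow_left₀ (by positivity) hnε 2
    rwa [mul_pow, hsq] at this
  have hinvm : m⁻¹ ≤ ε ^ 2 / 10000 := by
    rw [inv_le_iff_one_le_mul₀ hm]; linarith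
  have hinvn : n⁻¹ ≤ ε ^ 2 / 7000 := by
    rw [inv_le_iff_one_le_mul₀ hn]
    nlinarith [mul_le_mul_of_nonneg_right hnε hε.le]
  have hfirst : N * ε ^ 2 * n⁻¹ ^ 2 ≤ ε ^ 4 / 10000 ^ 2 := by
    rw [inv_pow, ← div_eq_mul_inv, div_le_iff₀ (by positivity)]
    nlinarith [mul_le_mul_of_nonneg_right hn2 (sq_nonneg ε)]
  have hsecond : N * ε ^ 2 * (n⁻¹ * m⁻¹) ≤ 2 * ε ^ 4 / 10000 ^ 2 := by
    rw [← mul_inv, ← div_eq_mul_inv, div_le_iff₀ (by positivity)]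
    have h1 : N * ε ^ 2 ≤ 2 * (N * ε ^ 2) * (N * ε ^ 2) := by
      nlinarith [mul_nonneg hN (sq_nonneg ε)]
    have h2 := mul_le_mul_of_nonneg_right hmn (by positivity : 0 ≤ ε ^ 4)
    nlinarith
  have hAbound : A * (960 * n⁻¹ ^ 2 + 48 * (n⁻¹ * m⁻¹)) ≤
      960 * (ε ^ 4 / 10000 ^ 2) + 48 * (2 * ε ^ 4 / 10000 ^ 2) := by
    refine (mul_le_mul_of_nonneg_right hA (by positivity)).trans ?_
    linarith
  have hBbound : 24 * B * (n⁻¹ + m⁻¹) ≤ 24 * S * (ε ^ 2 / 7000 + ε ^ 2 / 10000) := by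
    gcongr
  have h4 : ε ^ 4 ≤ 16 * S ^ 2 := by nlinarith [sq_nonneg ε]
  have h2 : S * ε ^ 2 ≤ 4 * S ^ 2 := by nlinarith
  linarith [sq_nonneg S]

theorem Orthosymmetric.half_sub_mem {D : ℕ} {Γ : Set (Fin D → ℝ)} (hΓ : Orthosymmetric Γ)
    (hconv : Convex ℝ Γ) {θ₁ θ₂ : Fin D → ℝ} (h₁ : θ₁ ∈ Γ) (h₂ : θ₂ ∈ Γ) :
    (fun i => (θ₁ i - θ₂ i) / 2) ∈ Γ := by
  have hneg := hΓ θ₂ h₂ (fun _ => -1) fun _ => Or.inr rfl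
  convert hconv h₁ hneg (a := 1 / 2) (b := 1 / 2) (by norm_num) (by norm_num) (by norm_num) using 1
  ext i
  simp
  ring

theorem le_nEst_mul_sq {D : ℕ} {Γ : Set (Fin D → ℝ)} (hΓ : Orthosymmetric Γ)
    (hconv : Convex ℝ Γ) {ε : ℝ} (hε : 0 < ε) {θ₁ θ₂ : Fin D → ℝ} (h₁ : θ₁ ∈ Γ) (h₂ : θ₂ ∈ Γ)
    (hsep : ε ^ 2 ≤ ∑ i, (θ₁ i - θ₂ i) ^ 2) : 1 / 2 ≤ (nEst Γ (ε / 9) : ℝ) * ε ^ 2 := by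
  obtain ⟨est, hest, hrisk⟩ := nEst_spec Γ (div_pos hε (by norm_num : (0 : ℝ) < 9))
  by_contra! hlt
  set L := ∑ i, (θ₁ i - θ₂ i) ^ 2 with hL
  have hL0 : 0 < L := lt_of_lt_of_le (by positivity) hsep
  have hratio : ε ^ 2 / L ≤ 1 := div_le_one_of_le₀ hsep hL0.le
  let τ : Fin D → ℝ := fun i => √(ε ^ 2 / L) * ((θ₁ i - θ₂ i) / 2)
  have hτsq : ∀ i, τ i ^ 2 = ε ^ 2 / L * ((θ₁ i - θ₂ i) / 2) ^ 2 := fun i => by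
    simp only [τ]
    rw [mul_pow, Real.sq_sqrt (by positivity)]
  have hτsum : ∑ i, τ i ^ 2 = ε ^ 2 / 4 := by
    simp_rw [hτsq, ← Finset.mul_sum, div_pow, ← Finset.sum_div, ← hL]
    field_simp
    norm_num
  have hτle : ∀ i, τ i ^ 2 ≤ ε ^ 2 / 4 := fun i => by
    rw [← hτsum]
    exact Finset.single_le_sum (f := fun i => τ i ^ 2) (fun _ _ => sq_nonneg _) (Finset.mem_univ i)
  have h := sum_sq_le_of_estimator hΓ hconv hest hrisk (hΓ.half_sub_mem hconv h₁ h₂) (τ := τ)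
    (fun i => by
      rw [hτsq]
      exact mul_le_of_le_one_left (sq_nonneg _) hratio)
    (fun i => by
      have := mul_le_mul_of_nonneg_left (hτle i) (Nat.cast_nonneg (α := ℝ) (nEst Γ (ε / 9)))
      linarith)
  rw [hτsum] at h
  nlinarith [sq_pos_of_pos hε]

theorem exists_test_weights {D : ℕ} {Γ : Set (Fin D → ℝ)} (hΓ : Orthosymmetric Γ)
    (hcomp : IsCompact Γ) (hconv : Convex ℝ Γ) (hquad : QuadraticallyConvex Γ) {ε : ℝ} (hε : 0 < ε)
    (hne : Γ.Nonempty) (hN : 0 < nEst Γ (ε / 9)) :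
    ∃ w : Fin D → ℝ, (∀ i, 0 ≤ w i ∧ w i ≤ 1) ∧ ∑ i, w i ^ 2 ≤ nEst Γ (ε / 9) * ε ^ 2 ∧
      ∀ θ ∈ Γ, ∑ i, (1 - w i) ^ 2 * θ i ^ 2 ≤ 2 * (ε / 9) ^ 2 := by
  obtain ⟨est, hest, hrisk⟩ := nEst_spec Γ (div_pos hε (by norm_num : (0 : ℝ) < 9))
  have hN' : (0 : ℝ) < nEst Γ (ε / 9) := by exact_mod_cast hN
  set v : ℝ := 1 / (8 * nEst Γ (ε / 9)) with hv
  have hv0 : 0 < v := by positivity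
  obtain ⟨w, hw, hwrisk⟩ := exists_shrinkage_weights (v := v) (R := 2 * (ε / 9) ^ 2)
    (hcomp.image (f := fun θ : Fin D → ℝ => fun i => (θ i) ^ 2) (by fun_prop)) hquad (hne.image _)
    (by rintro _ ⟨θ, _, rfl⟩ i; exact sq_nonneg _) hv0
    (by
      rintro _ ⟨θ, hθ, rfl⟩
      have hsq : ∀ i, √(min (θ i ^ 2) v) ^ 2 = min (θ i ^ 2) v := fun i =>
        Real.sq_sqrt (le_min (sq_nonneg _) hv0.le)
      have h := sum_sq_le_of_estimator hΓ hconv hest hrisk hθ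
        (τ := fun i => √(min (θ i ^ 2) v)) (fun i => (hsq i).trans_le (min_le_left _ _))
        (fun i => by
          rw [hsq]
          refine (mul_le_mul_of_nonneg_left (min_le_right _ v) hN'.le).trans (le_of_eq ?_)
          rw [hv]
          field_simp)
      simpa only [hsq] using h)
  refine ⟨w, hw, ?_, fun θ hθ => ?_⟩
  · obtain ⟨θ, hθ⟩ := hne
    have h := hwrisk _ ⟨θ, hθ, rfl⟩
    have h0 : 0 ≤ ∑ i, (1 - w i) ^ 2 * θ i ^ 2 :=
      Finset.sum_nonneg fun _ _ => by positivity
    have h1 : v * ∑ i, w i ^ 2 ≤ 2 * (ε / 9) ^ 2 := by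
      simp only at h
      linarith
    rw [hv, div_mul_eq_mul_div, one_mul, div_le_iff₀ (by positivity)] at h1
    nlinarith [mul_pos hN' (sq_pos_of_pos hε)]
  · have h := hwrisk _ ⟨θ, hθ, rfl⟩
    have h0 : 0 ≤ v * ∑ i, w i ^ 2 := mul_nonneg hv0.le (Finset.sum_nonneg fun _ _ => sq_nonneg _)
    simp only at h
    linarith

theorem sum_weighted_sq_ge {D : ℕ} {w d : Fin D → ℝ} {ε : ℝ}
    (htail : ∑ i, (1 - w i) ^ 2 * (d i / 2) ^ 2 ≤ 2 * (ε / 9) ^ 2)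
    (hsep : ε ^ 2 ≤ ∑ i, d i ^ 2) : ε ^ 2 / 4 ≤ ∑ i, w i ^ 2 * d i ^ 2 := by
  have h : ∑ i, d i ^ 2 ≤ ∑ i, (2 * (w i ^ 2 * d i ^ 2) + 8 * ((1 - w i) ^ 2 * (d i / 2) ^ 2)) :=
    Finset.sum_le_sum fun i _ => by nlinarith [mul_nonneg (sq_nonneg (2 * w i - 1)) (sq_nonneg (d i))]
  rw [Finset.sum_add_distrib, ← Finset.mul_sum, ← Finset.mul_sum] at h
  nlinarith [sq_nonneg ε]

/-- For orthosymmetric, compact, convex, quadratically convex `Γ ⊆ ℝ^D`, there is a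
universal constant `c₀ > 0` such that `m ≥ c₀/ε²`, `n ≥ c₀ √(n_est(Γ, ε/9))/ε` and
`m n ≥ c₀² n_est(Γ, ε/9)²` imply `(m, n)` is LFHT-feasible at separation `ε`. -/
theorem lfht_upper_bound_quadConvex :
    ∃ c₀ : ℝ, 0 < c₀ ∧
      ∀ (D : ℕ), 0 < D → ∀ Γ : Set (Fin D → ℝ),
        Orthosymmetric Γ → IsCompact Γ → Convex ℝ Γ → QuadraticallyConvex Γ →
        ∀ ε : ℝ, 0 < ε → ∀ m n : ℕ, 0 < m → 0 < n →
          c₀ / ε ^ 2 ≤ (m : ℝ) →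
          c₀ * Real.sqrt (nEst Γ (ε / 9)) / ε ≤ (n : ℝ) →
          c₀ ^ 2 * (nEst Γ (ε / 9) : ℝ) ^ 2 ≤ (m : ℝ) * (n : ℝ) →
          LFHTFeasible Γ ε m n := by
  refine ⟨10000, by norm_num, fun D _ Γ hΓ hcomp hconv hquad ε hε m n hm hn hmε hnε hmn => ?_⟩
  have hsq : ∀ {θ₁ θ₂ : Fin D → ℝ}, ε ≤ euclNorm (θ₁ - θ₂) → ε ^ 2 ≤ ∑ i, (θ₁ i - θ₂ i) ^ 2 := by
    intro θ₁ θ₂ h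
    exact (Real.le_sqrt' hε).1 h
  by_cases hex : ∃ θ₁ ∈ Γ, ∃ θ₂ ∈ Γ, ε ≤ euclNorm (θ₁ - θ₂)
  swap
  · push Not at hex
    exact ⟨fun _ => true, measurable_const, fun θ₁ h₁ θ₂ h₂ h =>
      absurd h (not_le.2 (hex θ₁ h₁ θ₂ h₂))⟩
  obtain ⟨η₁, hη₁, η₂, hη₂, hη⟩ := hex
  have hNε := le_nEst_mul_sq hΓ hconv hε hη₁ hη₂ (hsq hη)
  have hN : 0 < nEst Γ (ε / 9) := by
    rcases Nat.eq_zero_or_pos (nEst Γ (ε / 9)) with h | h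
    · norm_num [h] at hNε
    · exact h
  obtain ⟨w, hw, hwsum, hwtail⟩ := exists_test_weights hΓ hcomp hconv hquad hε ⟨η₁, hη₁⟩ hN
  set a : Fin D → ℝ := fun i => w i ^ 2 with ha
  have ha1 : ∀ i, a i ^ 2 ≤ a i := fun i => by
    have h1 : a i ≤ 1 := pow_le_one₀ (hw i).1 (hw i).2
    nlinarith [sq_nonneg (w i)]
  have hdev : ∀ θ₁ ∈ Γ, ∀ θ₂ ∈ Γ, ε ≤ euclNorm (θ₁ - θ₂) → ∀ θ : Fin D → ℝ,
      θ = θ₁ ∨ θ = θ₂ → 0 < ∑ i, a i * (θ₁ i - θ₂ i) ^ 2 ∧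
      ((iidSamples n (gaussPi θ₁)).prod
        ((iidSamples n (gaussPi θ₂)).prod (iidSamples m (gaussPi θ))))
        {x | ∑ i, a i * (θ₁ i - θ₂ i) ^ 2 ≤ |lfhtStat a m n x -
          ∑ i, a i * ((θ₁ i - θ i) ^ 2 - (θ₂ i - θ i) ^ 2)|} ≤ 1 / 4 := by
    intro θ₁ h₁ θ₂ h₂ hsep θ hθ
    have hS := sum_weighted_sq_ge (hwtail _ (hΓ.half_sub_mem hconv h₁ h₂)) (hsq hsep)
    have hS0 : 0 < ∑ i, a i * (θ₁ i - θ₂ i) ^ 2 := lt_of_lt_of_le (by positivity) hS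
    refine ⟨hS0, lfhtStat_deviation hm hn a θ₁ θ₂ θ hS0 ?_⟩
    have hpair : ∀ i, (θ₁ i - θ i) ^ 2 + (θ₂ i - θ i) ^ 2 = (θ₁ i - θ₂ i) ^ 2 := fun i => by
      rcases hθ with rfl | rfl <;> ring
    have hbudget := variance_budget (A := ∑ i, a i ^ 2)
      (B := ∑ i, a i ^ 2 * (θ₁ i - θ₂ i) ^ 2) hε (Nat.cast_pos.2 hm) (Nat.cast_pos.2 hn)
      (Nat.cast_nonneg _) hNε hmε hnε hmn
      ((Finset.sum_le_sum fun i _ => ha1 i).trans hwsum)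
      (Finset.sum_le_sum fun i _ => mul_le_mul_of_nonneg_right (ha1 i) (sq_nonneg (θ₁ i - θ₂ i))) hS
    refine le_trans (le_of_eq ?_) hbudget
    simp_rw [hpair]
    rw [Finset.sum_mul, Finset.mul_sum, Finset.sum_mul, ← Finset.sum_add_distrib]
    exact Finset.sum_congr rfl fun i _ => by ring
  refine ⟨fun x => decide (0 < lfhtStat a m n x), ?_, fun θ₁ h₁ θ₂ h₂ hsep => ⟨?_, ?_⟩⟩
  · exact measurable_to_bool (by
      simpa [Set.preimage] using measurableSet_lt measurable_const (measurable_lfhtStat a m n))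
  · refine (measure_mono fun x hx => ?_).trans (hdev θ₁ h₁ θ₂ h₂ hsep θ₁ (Or.inl rfl)).2
    have hx' : 0 < lfhtStat a m n x := by simpa using hx
    have hmean : ∑ i, a i * ((θ₁ i - θ₁ i) ^ 2 - (θ₂ i - θ₁ i) ^ 2) =
        -∑ i, a i * (θ₁ i - θ₂ i) ^ 2 := by
      rw [← Finset.sum_neg_distrib]
      exact Finset.sum_congr rfl fun i _ => by ring
    rw [Set.mem_ofPred_eq, hmean]
    exact le_trans (by linarith) (le_abs_self _)
  · refine (measure_mono fun x hx => ?_).trans (hdev θ₁ h₁ θ₂ h₂ hsep θ₂ (Or.inr rfl)).2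
    have hx' : lfhtStat a m n x ≤ 0 := by simpa using hx
    have hmean : ∑ i, a i * ((θ₁ i - θ₂ i) ^ 2 - (θ₂ i - θ₂ i) ^ 2) =
        ∑ i, a i * (θ₁ i - θ₂ i) ^ 2 :=
      Finset.sum_congr rfl fun i _ => by ring
    rw [Set.mem_ofPred_eq, hmean]
    exact le_trans (by linarith) (neg_le_abs _)
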